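/- arXiv:2510.25311 — 2 statements merged into one kernel-verified Lean document; each statement's English description precedes it below -/
import Mathlib

section
/- Let C ≥ 0, let K ≥ 1 be a natural number, let ε : ℕ → ℝ, and let h : ℕ → ℝ satisfy, for every k with 1 ≤ k ≤ K, h(k) ≤ (1 - 2/(k+1))·h(k-1) + (C/2)·(2/(k+1))² + (2/(k+1))·ε(k). Then h(K) ≤ 2C/(K+1) + (2/(K·(K+1)))·Σ_{k=1}^{K} k·ε(k). -/
/-- One step of the Frank–Wolfe recursion, multiplied through by `k * (k + 1)`. -/
lemma weighted_frank_wolfe_step {C x a b e : ℝ} (hC : 0 ≤ C) (hx : 0 ≤ x)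
    (hstep : b ≤ (1 - 2 / (x + 1)) * a + (C / 2) * (2 / (x + 1)) ^ 2 + (2 / (x + 1)) * e) :
    x * (x + 1) * b ≤ (x - 1) * x * a + 2 * C + 2 * (x * e) := by
  have hx1 : 0 < x + 1 := by linarith
  calc x * (x + 1) * b
      ≤ x * (x + 1) *
          ((1 - 2 / (x + 1)) * a + (C / 2) * (2 / (x + 1)) ^ 2 + (2 / (x + 1)) * e) := by
        gcongr
    _ = (x - 1) * x * a + 2 * C * (x / (x + 1)) + 2 * (x * e) := by
        field_simp
        ring
    _ ≤ (x - 1) * x * a + 2 * C + 2 * (x * e) := by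
        have hfrac : x / (x + 1) ≤ 1 := (div_le_one hx1).2 (by linarith)
        have := mul_le_of_le_one_right (by linarith : 0 ≤ 2 * C) hfrac
        linarith

/-- Frank–Wolfe convergence recursion with step sizes `λ_k = 2/(k+1)`. -/
theorem frank_wolfe_recursion (C : ℝ) (hC : 0 ≤ C) (K : ℕ) (hK : 1 ≤ K)
    (ε h : ℕ → ℝ)
    (hrec : ∀ k : ℕ, 1 ≤ k → k ≤ K →
      h k ≤ (1 - 2 / ((k : ℝ) + 1)) * h (k - 1)
            + (C / 2) * (2 / ((k : ℝ) + 1)) ^ 2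
            + (2 / ((k : ℝ) + 1)) * ε k) :
    h K ≤ 2 * C / ((K : ℝ) + 1)
          + (2 / ((K : ℝ) * ((K : ℝ) + 1))) * ∑ k ∈ Finset.Icc 1 K, (k : ℝ) * ε k := by
  have weighted : ∀ n : ℕ, n ≤ K →
      (n : ℝ) * (n + 1) * h n ≤ 2 * C * n + 2 * ∑ k ∈ Finset.Icc 1 n, (k : ℝ) * ε k := by
    intro n
    induction n with
    | zero => simp
    | succ n ih =>
      intro hn
      have hstep := weighted_frank_wolfe_step hC (Nat.cast_nonneg _)
        (hrec (n + 1) (Nat.le_add_left 1 n) hn)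
      have hprev := ih (Nat.le_of_succ_le hn)
      rw [Finset.sum_Icc_succ_top (Nat.le_add_left 1 n)]
      simp only [Nat.add_sub_cancel] at hstep
      push_cast at hstep ⊢
      linarith
  have hK0 : (0 : ℝ) < K := by exact_mod_cast hK
  have hpos : (0 : ℝ) < (K : ℝ) * (K + 1) := by positivity
  refine le_of_mul_le_mul_left ((weighted K le_rfl).trans_eq ?_) hpos
  field_simp
end

section
/- Let V ≥ 1 and M ≥ 1 be real numbers, let δ ∈ (0,1], let d be a natural number, and set ε = (48·214·V⁴/M)·( log(28·e·(d+1)/δ) + d·log(640·V²·M) ). Then ε > 0 and ε·M/(48·214·V⁴) - log(28·e·(d+1)) - d·log(640·V²) + d·log(ε) ≥ log(1/δ). -/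
open Real

/-- the explicit choice of ε satisfies `χ(ε) ≥ log(1/δ)` in the FQI analysis. -/
theorem fqi_epsilon_choice (V M : ℝ) (hV : 1 ≤ V) (hM : 1 ≤ M)
    (δ : ℝ) (hδ0 : 0 < δ) (hδ1 : δ ≤ 1) (d : ℕ)
    (ε : ℝ)
    (hε : ε = (48 * 214 * V ^ 4 / M) *
      (Real.log (28 * Real.exp 1 * ((d : ℝ) + 1) / δ)
        + (d : ℝ) * Real.log (640 * V ^ 2 * M))) :
    0 < ε ∧
    ε * M / (48 * 214 * V ^ 4)
      - Real.log (28 * Real.exp 1 * ((d : ℝ) + 1))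
      - (d : ℝ) * Real.log (640 * V ^ 2)
      + (d : ℝ) * Real.log ε
      ≥ Real.log (1 / δ) := by
  have hM0 : 0 < M := by linarith
  have hV2 : 1 ≤ V ^ 2 := one_le_pow₀ hV
  have hV4 : 1 ≤ V ^ 4 := one_le_pow₀ hV
  have hd : (0 : ℝ) ≤ d := d.cast_nonneg
  have hB : 0 ≤ Real.log (640 * V ^ 2 * M) := Real.log_nonneg (by nlinarith)
  have hA : 1 ≤ Real.log (28 * Real.exp 1 * ((d : ℝ) + 1) / δ) := by
    rw [Real.le_log_iff_exp_le (by positivity), le_div_iff₀ hδ0]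
    have he := Real.exp_pos 1
    nlinarith [mul_nonneg he.le hd, mul_le_mul_of_nonneg_left hδ1 he.le]
  have hS : 1 ≤ Real.log (28 * Real.exp 1 * ((d : ℝ) + 1) / δ)
      + (d : ℝ) * Real.log (640 * V ^ 2 * M) := by
    linarith [mul_nonneg hd hB]
  have hε0 : 0 < ε := by
    rw [hε]
    exact mul_pos (by positivity) (by linarith)
  have hεC : ε * M / (48 * 214 * V ^ 4) = Real.log (28 * Real.exp 1 * ((d : ℝ) + 1) / δ)
      + (d : ℝ) * Real.log (640 * V ^ 2 * M) := by
    rw [hε]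
    field_simp
  have hεM : 1 ≤ ε * M := by
    rw [← hεC, le_div_iff₀ (by positivity)] at hS
    linarith
  have hlog : 0 ≤ (d : ℝ) * (Real.log ε + Real.log M) := by
    rw [← Real.log_mul hε0.ne' hM0.ne']
    exact mul_nonneg hd (Real.log_nonneg hεM)
  refine ⟨hε0, ?_⟩
  rw [hεC, Real.log_div (by positivity) hδ0.ne',
    Real.log_mul (x := 640 * V ^ 2) (by positivity) hM0.ne', one_div, Real.log_inv]
  linarith
end
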